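/- For every integer N ≥ 300, the genus of the modular curve X_0(N) satisfies g(X_0(N)) ≥ N/49. Moreover, for every integer N ≥ 1 one has N ≤ 49 · max{1, g(X_0(N))}. -/

import Mathlib

/-!
Genus bounds for the modular curves `X₀(N)`.

The genus of the compactified modular curve `X₀(N)` over `ℂ` is given by the classical
formula
`g(X₀(N)) = 1 + ψ(N)/12 − ν₂(N)/4 − ν₃(N)/3 − ν∞(N)/2`,
where `ψ(N) = [SL₂(ℤ) : Γ₀(N)] = N · ∏_{ℓ ∣ N} (1 + 1/ℓ)` (product over prime
divisors), `ν∞(N) = ∑_{d ∣ N} φ(gcd(d, N/d))`, and `ν₂`, `ν₃` count the elliptic points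
of order `2` and `3`, expressed by the products below involving the quadratic characters
`ℓ ↦ (−1/ℓ)` (which is `1`, `−1`, `0` according as `ℓ ≡ 1, 3 mod 4`, `ℓ = 2`) and
`ℓ ↦ (−3/ℓ)` (which is `1`, `−1`, `0` according as `ℓ ≡ 1, 2 mod 3`, `ℓ = 3`).
We take this formula as the definition of `g(X₀(N))`.
-/

/-- The quadratic (Legendre) character `ℓ ↦ (−1/ℓ)`. -/
def chiNegOne (n : ℕ) : ℤ :=
  if n % 4 = 1 then 1 else if n % 4 = 3 then -1 else 0

/-- The quadratic (Legendre) character `ℓ ↦ (−3/ℓ)`. -/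
def chiNegThree (n : ℕ) : ℤ :=
  if n % 3 = 1 then 1 else if n % 3 = 2 then -1 else 0

/-- `ψ(N) = [SL₂(ℤ) : Γ₀(N)] = N · ∏_{ℓ ∣ N prime} (1 + 1/ℓ)`. -/
def psiX0 (N : ℕ) : ℚ :=
  N * ∏ ℓ ∈ N.primeFactors, (1 + (ℓ : ℚ)⁻¹)

/-- `ν₂(N)`, the number of elliptic points of order `2` of `X₀(N)`. -/
def nuTwo (N : ℕ) : ℤ :=
  if 4 ∣ N then 0 else ∏ ℓ ∈ N.primeFactors, (1 + chiNegOne ℓ)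

/-- `ν₃(N)`, the number of elliptic points of order `3` of `X₀(N)`. -/
def nuThree (N : ℕ) : ℤ :=
  if 9 ∣ N then 0 else ∏ ℓ ∈ N.primeFactors, (1 + chiNegThree ℓ)

/-- `ν∞(N) = ∑_{d ∣ N} φ(gcd(d, N/d))`, the number of cusps of `X₀(N)`. -/
def nuInfty (N : ℕ) : ℕ :=
  ∑ d ∈ N.divisors, Nat.totient (Nat.gcd d (N / d))

/-- The genus of the modular curve `X₀(N)`, given by the classical formula. -/
def genusX0 (N : ℕ) : ℚ :=
  1 + psiX0 N / 12 - nuTwo N / 4 - nuThree N / 3 - nuInfty N / 2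

theorem nuInfty_mul {a b : ℕ} (hab : a.Coprime b) : nuInfty (a * b) = nuInfty a * nuInfty b := by
  unfold nuInfty
  rw [Nat.divisors_mul, Finset.mul_def, Finset.sum_image hab.mul_injOn_divisors,
    Finset.sum_product, Finset.sum_mul_sum]
  refine Finset.sum_congr rfl fun d hd => Finset.sum_congr rfl fun e he => ?_
  obtain ⟨⟨a', rfl⟩, ha⟩ := Nat.mem_divisors.1 hd
  obtain ⟨⟨b', rfl⟩, hb⟩ := Nat.mem_divisors.1 he
  have hd0 : 0 < d := Nat.pos_of_mem_divisors hd
  have he0 : 0 < e := Nat.pos_of_mem_divisors he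
  obtain ⟨h₁, h₂⟩ := Nat.coprime_mul_iff_left.1 hab
  obtain ⟨hde, hdb⟩ := Nat.coprime_mul_iff_right.1 h₁
  obtain ⟨hae, hab'⟩ := Nat.coprime_mul_iff_right.1 h₂
  have hdiv : d * a' * (e * b') / (d * e) = a' * b' := by
    rw [show d * a' * (e * b') = d * e * (a' * b') by ring]
    exact Nat.mul_div_cancel_left _ (Nat.mul_pos hd0 he0)
  rw [hdiv, Nat.mul_div_cancel_left _ hd0, Nat.mul_div_cancel_left _ he0,
    hab'.gcd_mul, Nat.Coprime.gcd_mul_right_cancel d hae.symm,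
    Nat.Coprime.gcd_mul_left_cancel e hdb, Nat.totient_mul]
  exact (hde.coprime_dvd_left (Nat.gcd_dvd_left _ _)).coprime_dvd_right (Nat.gcd_dvd_left _ _)

theorem nuInfty_prime_pow {p : ℕ} (hp : p.Prime) (r : ℕ) :
    nuInfty (p ^ r) = ∑ i ∈ Finset.range (r + 1), Nat.totient (p ^ min i (r - i)) := by
  rw [nuInfty, Nat.sum_divisors_prime_pow hp]
  refine Finset.sum_congr rfl fun i hi => ?_
  have hir : i ≤ r := Nat.lt_succ_iff.1 (Finset.mem_range.1 hi)
  rw [Nat.pow_div hir hp.pos]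
  rcases le_total i (r - i) with h | h
  · rw [min_eq_left h, Nat.gcd_eq_left (pow_dvd_pow p h)]
  · rw [min_eq_right h, Nat.gcd_eq_right (pow_dvd_pow p h)]

theorem nuInfty_prime {p : ℕ} (hp : p.Prime) : nuInfty p = 2 := by
  simpa [Finset.sum_range_succ] using nuInfty_prime_pow hp 1

theorem nuInfty_prime_sq {p : ℕ} (hp : p.Prime) : nuInfty (p ^ 2) = p + 1 := by
  have := hp.one_lt
  simp [nuInfty_prime_pow hp, Finset.sum_range_succ, Nat.totient_prime hp]
  omega

/-- Two more factors of `p` multiply the number of cusps by `p`. -/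
theorem nuInfty_prime_pow_add_three {p : ℕ} (hp : p.Prime) (r : ℕ) :
    nuInfty (p ^ (r + 3)) = p * nuInfty (p ^ (r + 1)) := by
  have hstep : ∀ i ∈ Finset.range r, Nat.totient (p ^ min (i + 1 + 1) (r + 3 - (i + 1 + 1))) =
      p * Nat.totient (p ^ min (i + 1) (r + 1 - (i + 1))) := by
    intro i hi
    have hir := Finset.mem_range.1 hi
    obtain ⟨m, hm⟩ : ∃ m, min (i + 1) (r + 1 - (i + 1)) = m + 1 :=
      ⟨min (i + 1) (r + 1 - (i + 1)) - 1, by omega⟩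
    rw [hm, show min (i + 1 + 1) (r + 3 - (i + 1 + 1)) = m + 1 + 1 by omega,
      Nat.totient_prime_pow_succ hp, Nat.totient_prime_pow_succ hp]
    ring
  obtain ⟨q, rfl⟩ : ∃ q, p = q + 1 := ⟨p - 1, by have := hp.pos; omega⟩
  rw [nuInfty_prime_pow hp, nuInfty_prime_pow hp, Finset.sum_range_succ', Finset.sum_range_succ,
    Finset.sum_range_succ', Finset.sum_range_succ, Finset.sum_range_succ',
    Finset.sum_range_succ, Finset.sum_congr rfl hstep, ← Finset.mul_sum]
  have h₁ : min (0 + 1) (r + 3 - (0 + 1)) = 1 := by omega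
  have h₂ : min (r + 1 + 1) (r + 3 - (r + 1 + 1)) = 1 := by omega
  have h₃ : min (r + 2 + 1) (r + 3 - (r + 2 + 1)) = 0 := by omega
  have h₄ : min (r + 1) (r + 1 - (r + 1)) = 0 := by omega
  simp [Nat.totient_prime hp]
  ring

theorem psiX0_mul {a b : ℕ} (hab : a.Coprime b) : psiX0 (a * b) = psiX0 a * psiX0 b := by
  unfold psiX0
  rw [hab.primeFactors_mul, Finset.prod_union hab.disjoint_primeFactors]
  push_cast
  ring

theorem psiX0_prime_pow_succ {p : ℕ} (hp : p.Prime) (r : ℕ) :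
    psiX0 (p ^ (r + 1)) = p ^ r * (p + 1) := by
  have : (p : ℚ) ≠ 0 := mod_cast hp.ne_zero
  rw [psiX0, Nat.primeFactors_prime_pow r.succ_ne_zero hp, Finset.prod_singleton]
  push_cast
  field_simp
  ring

theorem nuInfty_sq_mul_le_of_prime_pow {p : ℕ} (hp : p.Prime) (r : ℕ) :
    (nuInfty (p ^ (r + 1)) : ℚ) ^ 2 * (p ^ (r + 1) : ℕ) ≤ psiX0 (p ^ (r + 1)) ^ 2 := by
  induction r using Nat.twoStepInduction with
  | zero =>
    rw [psiX0_prime_pow_succ hp, zero_add, pow_one, nuInfty_prime hp]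
    push_cast
    nlinarith [sq_nonneg ((p : ℚ) - 1)]
  | one =>
    rw [psiX0_prime_pow_succ hp, nuInfty_prime_sq hp]
    push_cast
    apply le_of_eq
    ring
  | more r ih _ =>
    rw [psiX0_prime_pow_succ hp] at ih ⊢
    rw [nuInfty_prime_pow_add_three hp]
    push_cast at ih ⊢
    calc ((p : ℚ) * nuInfty (p ^ (r + 1))) ^ 2 * (p : ℚ) ^ (r + 2 + 1)
        = (p : ℚ) ^ 4 * ((nuInfty (p ^ (r + 1)) : ℚ) ^ 2 * (p : ℚ) ^ (r + 1)) := by ring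
      _ ≤ (p : ℚ) ^ 4 * ((p : ℚ) ^ r * (p + 1)) ^ 2 := by gcongr
      _ = ((p : ℚ) ^ (r + 2) * (p + 1)) ^ 2 := by ring

/-- `ν∞(N) ≤ ψ(N) / √N`, stated without square roots. -/
theorem nuInfty_sq_mul_le (N : ℕ) : (nuInfty N : ℚ) ^ 2 * N ≤ psiX0 N ^ 2 := by
  induction N using Nat.recOnPosPrimePosCoprime with
  | zero => simp [psiX0]
  | one => simp [psiX0, nuInfty]
  | prime_pow p n hp hn =>
    obtain ⟨r, rfl⟩ := Nat.exists_eq_succ_of_ne_zero hn.ne'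
    exact nuInfty_sq_mul_le_of_prime_pow hp r
  | coprime a b _ _ hab iha ihb =>
    rw [nuInfty_mul hab, psiX0_mul hab]
    push_cast
    have := mul_le_mul iha ihb (by positivity) (by positivity)
    linarith

theorem le_psiX0 (N : ℕ) : (N : ℚ) ≤ psiX0 N := by
  refine le_mul_of_one_le_right N.cast_nonneg (Finset.one_le_prod fun p => ?_)
  simp

/-- `2 ^ ω(N) ≤ ψ(N) / √N`, stated without square roots. -/
theorem two_pow_card_primeFactors_sq_mul_le (N : ℕ) :
    ((2 : ℚ) ^ N.primeFactors.card) ^ 2 * N ≤ psiX0 N ^ 2 := by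
  rcases N.eq_zero_or_pos with rfl | hN
  · simp [psiX0]
  have hprod : ((∏ p ∈ N.primeFactors, p : ℕ) : ℚ) ≤ N :=
    mod_cast Nat.le_of_dvd hN N.prod_primeFactors_dvd
  have hlocal : ((2 : ℚ) ^ N.primeFactors.card) ^ 2 ≤
      (∏ p ∈ N.primeFactors, p : ℕ) * (∏ p ∈ N.primeFactors, (1 + (p : ℚ)⁻¹)) ^ 2 := by
    rw [← Finset.prod_const, ← Finset.prod_pow, ← Finset.prod_pow]
    push_cast
    rw [← Finset.prod_mul_distrib]
    refine Finset.prod_le_prod (fun _ _ => by positivity) fun p hp => ?_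
    have hp0 : (0 : ℚ) < p := mod_cast (Nat.prime_of_mem_primeFactors hp).pos
    have : (p : ℚ) * (1 + (p : ℚ)⁻¹) ^ 2 - 2 ^ 2 = (p - 1) ^ 2 / p := by
      field_simp
      ring
    have : 0 ≤ ((p : ℚ) - 1) ^ 2 / p := by positivity
    linarith
  calc ((2 : ℚ) ^ N.primeFactors.card) ^ 2 * N
      ≤ (N * (∏ p ∈ N.primeFactors, (1 + (p : ℚ)⁻¹)) ^ 2) * N := by
        gcongr
        exact hlocal.trans (by gcongr)
    _ = psiX0 N ^ 2 := by
        rw [psiX0]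
        ring

theorem prod_one_add_le_two_pow {χ : ℕ → ℤ} (hχ : ∀ n, -1 ≤ χ n ∧ χ n ≤ 1) (s : Finset ℕ) :
    ∏ ℓ ∈ s, (1 + χ ℓ) ≤ 2 ^ s.card :=
  (Finset.prod_le_prod (fun ℓ _ => by linarith [hχ ℓ])
    fun ℓ _ => (by linarith [hχ ℓ] : 1 + χ ℓ ≤ 2)).trans_eq (Finset.prod_const 2)

theorem nuTwo_le (N : ℕ) : nuTwo N ≤ 2 ^ N.primeFactors.card := by
  unfold nuTwo
  split_ifs
  · positivity
  · refine prod_one_add_le_two_pow (fun n => ?_) _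
    unfold chiNegOne
    split_ifs <;> simp

theorem nuThree_le (N : ℕ) : nuThree N ≤ 2 ^ N.primeFactors.card := by
  unfold nuThree
  split_ifs
  · positivity
  · refine prod_one_add_le_two_pow (fun n => ?_) _
    unfold chiNegThree
    split_ifs <;> simp

theorem le_psiX0_div_of_sq_mul_le {N : ℕ} (hN : 300 ≤ N) {x : ℚ}
    (h : x ^ 2 * N ≤ psiX0 N ^ 2) : x ≤ 10 / 173 * psiX0 N := by
  have hN' : (300 : ℚ) ≤ N := mod_cast hN
  have hψ : (0 : ℚ) ≤ psiX0 N := N.cast_nonneg.trans (le_psiX0 N)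
  refine le_of_sq_le_sq ?_ (by positivity)
  nlinarith [mul_le_mul_of_nonneg_left hN' (sq_nonneg x)]

theorem div_le_genusX0 {N : ℕ} (hN : 300 ≤ N) : (N : ℚ) / 49 ≤ genusX0 N := by
  have hω := le_psiX0_div_of_sq_mul_le hN (two_pow_card_primeFactors_sq_mul_le N)
  have h₂ : (nuTwo N : ℚ) ≤ 2 ^ N.primeFactors.card := mod_cast nuTwo_le N
  have h₃ : (nuThree N : ℚ) ≤ 2 ^ N.primeFactors.card := mod_cast nuThree_le N
  have h_inf := le_psiX0_div_of_sq_mul_le hN (nuInfty_sq_mul_le N)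
  have hψ := le_psiX0 N
  have hN0 : (0 : ℚ) ≤ N := N.cast_nonneg
  unfold genusX0
  linarith

/-- The prime divisors of `N`, described so that the kernel can evaluate them. -/
def trialPrimeFactors (N : ℕ) : Finset ℕ :=
  N.divisors.filter fun p => 2 ≤ p ∧ ∀ m < p, m ∣ p → m = 1

theorem primeFactors_eq_trialPrimeFactors (N : ℕ) : N.primeFactors = trialPrimeFactors N := by
  ext p
  simp only [trialPrimeFactors, Nat.mem_primeFactors, Finset.mem_filter, Nat.mem_divisors,
    Nat.prime_def_lt]
  tauto

theorem le_genusX0_of_lt {N : ℕ} (h₁ : 50 ≤ N) (h₂ : N < 300) : (N : ℚ) ≤ 49 * genusX0 N := by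
  have key : ∀ n ∈ Finset.Ico 50 300, ((n : ℕ) : ℚ) ≤ 49 *
      (1 + n * (∏ ℓ ∈ trialPrimeFactors n, (1 + (ℓ : ℚ)⁻¹)) / 12 -
        (if 4 ∣ n then 0 else ∏ ℓ ∈ trialPrimeFactors n, (1 + chiNegOne ℓ) : ℤ) / 4 -
        (if 9 ∣ n then 0 else ∏ ℓ ∈ trialPrimeFactors n, (1 + chiNegThree ℓ) : ℤ) / 3 -
        nuInfty n / 2) := by
    decide +kernel
  simpa only [genusX0, psiX0, nuTwo, nuThree, primeFactors_eq_trialPrimeFactors] using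
    key N (Finset.mem_Ico.2 ⟨h₁, h₂⟩)

/-- **Genus bounds for `X₀(N)`.**  For every `N ≥ 300` one has `g(X₀(N)) ≥ N/49`;
moreover, for every `N ≥ 1` one has `N ≤ 49 · max {1, g(X₀(N))}`. -/
theorem genusX0_bounds :
    (∀ N : ℕ, 300 ≤ N → (N : ℚ) / 49 ≤ genusX0 N) ∧
      ∀ N : ℕ, 1 ≤ N → (N : ℚ) ≤ 49 * max 1 (genusX0 N) := by
  refine ⟨fun N hN => div_le_genusX0 hN, fun N _ => ?_⟩
  have hmax₁ := le_max_left 1 (genusX0 N)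
  have hmax₂ := le_max_right 1 (genusX0 N)
  rcases lt_or_ge N 50 with h | h
  · have : (N : ℚ) ≤ 49 := mod_cast Nat.le_of_lt_succ h
    linarith
  rcases lt_or_ge N 300 with h' | h'
  · linarith [le_genusX0_of_lt h h']
  · linarith [div_le_genusX0 h']
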